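/- arXiv:1802.06400 — 3 statements merged into one kernel-verified Lean document; each statement's English description precedes it below -/
import Mathlib

section
/- Let P and R be weak hyperdoctrines on the same base category C and let r : P ⇒ R be a 1-arrow of doctrines over the identity of C which is a right adjoint, i.e. there is a 1-arrow l : R ⇒ P with Id_R ≤ r∘l and l∘r ≤ Id_P. Then for every pair of objects X, Y of C and every α in P(X×Y) one has r_X(∀^P_{pr₁}(α)) = ∀^R_{pr₁}(r_{X×Y}(α)). Moreover, r commutes with Heyting implication (r_A(γ ⟹^P β) = r_A(γ) ⟹^R r_A(β) for all γ, β in P(A)) if and only if the adjoint pair satisfies Frobenius reciprocity, i.e. l_A(β) ∧ α = l_A(β ∧ r_A(α)) for all A, all α in P(A) and β in R(A). -/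
universe u v w

/-- A category with a chosen terminal object and chosen binary products. -/
structure FPCat : Type (max (u+1) (v+1)) where
  Obj : Type u
  Hom : Obj → Obj → Type v
  id : (A : Obj) → Hom A A
  comp : {A B C : Obj} → Hom A B → Hom B C → Hom A C
  id_comp : ∀ {A B : Obj} (f : Hom A B), comp (id A) f = f
  comp_id : ∀ {A B : Obj} (f : Hom A B), comp f (id B) = f
  assoc : ∀ {A B C D : Obj} (f : Hom A B) (g : Hom B C) (h : Hom C D),
    comp (comp f g) h = comp f (comp g h)
  unit : Obj
  bang : (A : Obj) → Hom A unit
  bang_uniq : ∀ {A : Obj} (f : Hom A unit), f = bang A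
  prod : Obj → Obj → Obj
  p1 : {A B : Obj} → Hom (prod A B) A
  p2 : {A B : Obj} → Hom (prod A B) B
  pair : {X A B : Obj} → Hom X A → Hom X B → Hom X (prod A B)
  pair_p1 : ∀ {X A B : Obj} (f : Hom X A) (g : Hom X B), comp (pair f g) p1 = f
  pair_p2 : ∀ {X A B : Obj} (f : Hom X A) (g : Hom X B), comp (pair f g) p2 = g
  pair_uniq : ∀ {X A B : Obj} (h : Hom X (prod A B)),
    pair (comp h p1) (comp h p2) = h

namespace FPCat
variable (C : FPCat)

/-- The product of two arrows. -/
def pmap {A B A' B' : C.Obj} (f : C.Hom A A') (g : C.Hom B B') :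
    C.Hom (C.prod A B) (C.prod A' B') :=
  C.pair (C.comp C.p1 f) (C.comp C.p2 g)

/-- The diagonal arrow. -/
def diag (A : C.Obj) : C.Hom A (C.prod A A) := C.pair (C.id A) (C.id A)

/-- The swap arrow. -/
def swap (A B : C.Obj) : C.Hom (C.prod A B) (C.prod B A) := C.pair C.p2 C.p1

/-- Monomorphisms. -/
def Mono {X A : C.Obj} (m : C.Hom X A) : Prop :=
  ∀ {Z : C.Obj} (g h : C.Hom Z X), C.comp g m = C.comp h m → g = h

/-- A weak evaluation arrow, exhibiting `W` as a weak exponential of `B` with `A`. -/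
def IsWeakEval {W A B : C.Obj} (ev : C.Hom (C.prod W A) B) : Prop :=
  ∀ {X : C.Obj} (f : C.Hom (C.prod X A) B),
    ∃ g : C.Hom X W, C.comp (C.pmap g (C.id A)) ev = f

/-- The base category is weakly cartesian closed. -/
def WCC : Prop :=
  ∀ A B : C.Obj, ∃ (W : C.Obj) (ev : C.Hom (C.prod W A) B), C.IsWeakEval ev

/-- A commuting square which is a weak pullback. -/
def IsWpbSquare {A B X W : C.Obj} (f : C.Hom B A) (u : C.Hom X A)
    (q1 : C.Hom W B) (q2 : C.Hom W X) : Prop :=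
  C.comp q1 f = C.comp q2 u ∧
  ∀ {V : C.Obj} (v1 : C.Hom V B) (v2 : C.Hom V X), C.comp v1 f = C.comp v2 u →
    ∃ m : C.Hom V W, C.comp m q1 = v1 ∧ C.comp m q2 = v2

/-- A commuting square which is a (strong) pullback. -/
def IsPbSquare {A B X W : C.Obj} (f : C.Hom B A) (u : C.Hom X A)
    (q1 : C.Hom W B) (q2 : C.Hom W X) : Prop :=
  C.IsWpbSquare f u q1 q2 ∧
  ∀ {V : C.Obj} (m m' : C.Hom V W),
    C.comp m q1 = C.comp m' q1 → C.comp m q2 = C.comp m' q2 → m = m'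

/-- A parameterized natural number object. -/
def IsPnno {N : C.Obj} (z : C.Hom C.unit N) (s : C.Hom N N) : Prop :=
  ∀ {A X : C.Obj} (a : C.Hom A X) (f : C.Hom X X),
    ∃! k : C.Hom (C.prod A N) X,
      C.comp (C.pair (C.id A) (C.comp (C.bang A) z)) k = a ∧
      C.comp (C.pmap (C.id A) s) k = C.comp k f

end FPCat

/-- A weak hyperdoctrine (the weak cartesian closure of the base is
stated separately, as `FPCat.WCC`): an elementary doctrine with Heyting
fibres, Heyting substitution maps, with both adjoints to substitution along
product projections, satisfying the Beck-Chevalley condition. -/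
structure WHD (C : FPCat.{u, v}) : Type (max u v (w + 1)) where
  fib : C.Obj → Type w
  [ha : (A : C.Obj) → HeytingAlgebra (fib A)]
  sub : {A B : C.Obj} → C.Hom A B → fib B → fib A
  sub_id : ∀ {A : C.Obj} (α : fib A), sub (C.id A) α = α
  sub_comp : ∀ {A B D : C.Obj} (f : C.Hom A B) (g : C.Hom B D) (α : fib D),
    sub (C.comp f g) α = sub f (sub g α)
  sub_top : ∀ {A B : C.Obj} (f : C.Hom A B), sub f (⊤ : fib B) = ⊤
  sub_bot : ∀ {A B : C.Obj} (f : C.Hom A B), sub f (⊥ : fib B) = ⊥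
  sub_inf : ∀ {A B : C.Obj} (f : C.Hom A B) (α β : fib B),
    sub f (α ⊓ β) = sub f α ⊓ sub f β
  sub_sup : ∀ {A B : C.Obj} (f : C.Hom A B) (α β : fib B),
    sub f (α ⊔ β) = sub f α ⊔ sub f β
  sub_himp : ∀ {A B : C.Obj} (f : C.Hom A B) (α β : fib B),
    sub f (α ⇨ β) = sub f α ⇨ sub f β
  delta : (A : C.Obj) → fib (C.prod A A)
  delta_adj : ∀ {X A : C.Obj} (α : fib (C.prod X A)) (β : fib (C.prod (C.prod X A) A)),
    (sub C.p1 α ⊓ sub (C.pmap C.p2 (C.id A)) (delta A) ≤ β) ↔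
      α ≤ sub (C.pair (C.id (C.prod X A)) C.p2) β
  ex : {A B : C.Obj} → fib (C.prod A B) → fib A
  all : {A B : C.Obj} → fib (C.prod A B) → fib A
  ex_adj : ∀ {A B : C.Obj} (α : fib (C.prod A B)) (γ : fib A),
    ex α ≤ γ ↔ α ≤ sub C.p1 γ
  all_adj : ∀ {A B : C.Obj} (α : fib (C.prod A B)) (γ : fib A),
    sub C.p1 γ ≤ α ↔ γ ≤ all α
  bc_ex : ∀ {X A B : C.Obj} (f : C.Hom X A) (α : fib (C.prod A B)),
    ex (sub (C.pmap f (C.id B)) α) = sub f (ex α)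
  bc_all : ∀ {X A B : C.Obj} (f : C.Hom X A) (α : fib (C.prod A B)),
    sub f (all α) = all (sub (C.pmap f (C.id B)) α)

attribute [instance] WHD.ha

namespace WHD

variable {C : FPCat} (P : WHD C)

/-- `P` has comprehensive diagonals: two parallel arrows are equal as soon as
they are `P`-provably equal. -/
def CompDiag : Prop :=
  ∀ {X A : C.Obj} (f g : C.Hom X A),
    (⊤ : P.fib X) ≤ P.sub (C.pair f g) (P.delta A) → f = g

/-- `c` is a weak comprehension of `α`. -/
def IsWeakComp {X A : C.Obj} (c : C.Hom X A) (α : P.fib A) : Prop :=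
  (⊤ : P.fib X) ≤ P.sub c α ∧
  ∀ {Z : C.Obj} (f : C.Hom Z A), (⊤ : P.fib Z) ≤ P.sub f α →
    ∃ f' : C.Hom Z X, C.comp f' c = f

/-- `P` has full weak comprehensions. -/
def HasFullWeakComp : Prop :=
  (∀ {A : C.Obj} (α : P.fib A), ∃ (X : C.Obj) (c : C.Hom X A), P.IsWeakComp c α) ∧
  (∀ {A X Y : C.Obj} (α β : P.fib A) (c : C.Hom X A) (d : C.Hom Y A),
    P.IsWeakComp c α → P.IsWeakComp d β → (∃ k : C.Hom X Y, C.comp k d = c) → α ≤ β)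

/-- The uniqueness part of `∃!b. R(a,b)`, as a predicate on `a : A`. -/
def uniqRel {A B : C.Obj} (R : P.fib (C.prod A B)) : P.fib A :=
  P.all (P.all
    ((P.sub C.p1 R ⊓ P.sub (C.pair (C.comp C.p1 C.p1) C.p2) R) ⇨
      P.sub (C.pmap C.p2 (C.id B)) (P.delta B)))

/-- The Axiom of Choice holds on the object `A`:
`∀a:A.∃b:B.R(a,b) ⊢ ∃f:W.∀a:A.R(a, ev(f,a))` for every weak evaluation `ev`. -/
def ACon (A : C.Obj) : Prop :=
  ∀ (B W : C.Obj) (ev : C.Hom (C.prod W A) B), C.IsWeakEval ev →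
    ∀ R : P.fib (C.prod A B),
      P.all (A := C.unit) (B := A) (P.sub C.p2 (P.ex R)) ≤
        P.ex (A := C.unit) (B := W) (P.sub C.p2 (P.all (P.sub (C.pair C.p2 ev) R)))

/-- The Axiom of Unique Choice holds on the object `A`. -/
def AUCon (A : C.Obj) : Prop :=
  ∀ (B W : C.Obj) (ev : C.Hom (C.prod W A) B), C.IsWeakEval ev →
    ∀ R : P.fib (C.prod A B),
      P.all (A := C.unit) (B := A) (P.sub C.p2 (P.ex R ⊓ P.uniqRel R)) ≤
        P.ex (A := C.unit) (B := W) (P.sub C.p2 (P.all (P.sub (C.pair C.p2 ev) R)))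

/-- The Axiom of Choice holds in `P`. -/
def AC : Prop := ∀ A : C.Obj, P.ACon A

/-- The Axiom of Unique Choice holds in `P`. -/
def AUC : Prop := ∀ A : C.Obj, P.AUCon A

/-- The Rule of Choice holds in `P`. -/
def RC : Prop :=
  ∀ {A B : C.Obj} (R : P.fib (C.prod A B)), (⊤ : P.fib A) ≤ P.ex R →
    ∃ f : C.Hom A B, (⊤ : P.fib A) ≤ P.sub (C.pair (C.id A) f) R

/-- A parameterized natural number object `(N, z, s)` satisfies induction in `P`. -/
def SatInd {N : C.Obj} (z : C.Hom C.unit N) (s : C.Hom N N) : Prop :=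
  ∀ {A : C.Obj} (φ : P.fib (C.prod A N)),
    (⊤ : P.fib A) ≤ P.sub (C.pair (C.id A) (C.comp (C.bang A) z)) φ →
    φ ≤ P.sub (C.pmap (C.id A) s) φ →
    (⊤ : P.fib (C.prod A N)) ≤ φ

/-- `P` is an arithmetic doctrine: the base has a pnno which satisfies
induction in `P`. -/
def Arithmetic : Prop :=
  ∃ (N : C.Obj) (z : C.Hom C.unit N) (s : C.Hom N N), C.IsPnno z s ∧ P.SatInd z s

end WHD

/-- A 1-arrow of doctrines over the identity functor of the base: a fibred
monotone map preserving finite infima, substitution, and the equality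
predicates. -/
structure DocMap {C : FPCat} (P R : WHD C) where
  map : {A : C.Obj} → P.fib A → R.fib A
  map_top : ∀ A : C.Obj, map (⊤ : P.fib A) = ⊤
  map_inf : ∀ {A : C.Obj} (α β : P.fib A), map (α ⊓ β) = map α ⊓ map β
  map_mono : ∀ {A : C.Obj} (α β : P.fib A), α ≤ β → map α ≤ map β
  map_nat : ∀ {A B : C.Obj} (f : C.Hom A B) (α : P.fib B),
    map (P.sub f α) = R.sub f (map α)
  map_delta : ∀ A : C.Obj, map (P.delta A) = R.delta A

/-- Let `P` and `R` be weak hyperdoctrines on the same base `C`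
and let `r : P ⇒ R` be a 1-arrow which is a right adjoint, with left adjoint
`l : R ⇒ P` (`Id_R ≤ r∘l` and `l∘r ≤ Id_P`).  Then `r` commutes with the
universal quantifier along product projections, and `r` commutes with Heyting
implication if and only if the adjoint pair satisfies Frobenius reciprocity. -/
theorem right_adjoint_commutes_with_forall_and_himp_iff_frobenius
    (C : FPCat) (hwcc : C.WCC) (P R : WHD C)
    (r : DocMap P R) (l : DocMap R P)
    (unit : ∀ {A : C.Obj} (β : R.fib A), β ≤ r.map (l.map β))
    (counit : ∀ {A : C.Obj} (α : P.fib A), l.map (r.map α) ≤ α) :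
    (∀ (X Y : C.Obj) (α : P.fib (C.prod X Y)),
        r.map (P.all α) = R.all (r.map α)) ∧
    ((∀ (A : C.Obj) (γ β : P.fib A), r.map (γ ⇨ β) = r.map γ ⇨ r.map β) ↔
      (∀ (A : C.Obj) (α : P.fib A) (β : R.fib A),
        l.map β ⊓ α = l.map (β ⊓ r.map α))) := by
  have adj : ∀ {A : C.Obj} (β : R.fib A) (α : P.fib A), l.map β ≤ α ↔ β ≤ r.map α :=
    fun β α => ⟨fun h => (unit β).trans (r.map_mono _ _ h),
      fun h => (l.map_mono _ _ h).trans (counit α)⟩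
  refine ⟨fun X Y α => eq_of_forall_le_iff fun γ => ?_, fun h A α β => ?_, fun h A γ β => ?_⟩
  · rw [← adj, ← P.all_adj, ← l.map_nat, adj, R.all_adj]
  · refine eq_of_forall_ge_iff fun δ => ?_
    rw [adj, ← le_himp_iff, ← le_himp_iff, adj, h]
  · refine eq_of_forall_le_iff fun δ => ?_
    rw [← adj, le_himp_iff, le_himp_iff, h, adj]
end

section
/- Suppose C has a parameterized natural number object. If P : C^op → InfSL is a weak hyperdoctrine with full weak comprehensions and comprehensive diagonals, then P is arithmetic, i.e. the pnno satisfies induction in P: for every A in C and φ in P(A×N), if ⊤ ⊢ φ(a,0) and φ(a,m) ⊢ φ(a,s(m)) in the logic of P, then ⊤ ⊢ φ(a,n). -/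
universe u v w

/-- Substitution is monotone. -/
theorem WHD.sub_mono {C : FPCat} (P : WHD C) {A B : C.Obj} (f : C.Hom A B)
    {α β : P.fib B} (h : α ≤ β) : P.sub f α ≤ P.sub f β := by
  rw [← inf_eq_left, ← P.sub_inf, inf_eq_left.mpr h]

/-- STATEMENT 4.  Suppose `C` has a parameterized natural number object.
If `P` is a weak hyperdoctrine with full weak comprehensions and comprehensive
diagonals, then `P` is arithmetic, i.e. the pnno satisfies induction in `P`. -/
theorem arithmetic_of_full_weak_comprehensions
    (C : FPCat) (hwcc : C.WCC) (P : WHD C)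
    (hcomp : P.HasFullWeakComp) (hdiag : P.CompDiag)
    (N : C.Obj) (z : C.Hom C.unit N) (s : C.Hom N N) (hN : C.IsPnno z s) :
    P.SatInd z s := by
  intro A φ h0 hs
  obtain ⟨X, c, hc, hlift⟩ := hcomp.1 φ
  obtain ⟨a, ha⟩ := hlift _ h0
  have hstep : (⊤ : P.fib X) ≤ P.sub (C.comp c (C.pmap (C.id A) s)) φ := by
    rw [P.sub_comp]
    exact hc.trans (P.sub_mono c hs)
  obtain ⟨f, hf⟩ := hlift _ hstep
  obtain ⟨k, ⟨hk0, hks⟩, -⟩ := hN a f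
  have hkc : C.comp k c = C.id (C.prod A N) := by
    refine (hN (C.pair (C.id A) (C.comp (C.bang A) z)) (C.pmap (C.id A) s)).unique
      ⟨?_, ?_⟩ ⟨C.comp_id _, ?_⟩
    · rw [← C.assoc, hk0, ha]
    · rw [← C.assoc, hks, C.assoc, hf, C.assoc]
    · rw [C.comp_id, C.id_comp]
  calc (⊤ : P.fib (C.prod A N)) = P.sub k ⊤ := (P.sub_top k).symm
    _ ≤ P.sub k (P.sub c φ) := P.sub_mono k hc
    _ = φ := by rw [← P.sub_comp, hkc, P.sub_id]
end

section
/- Let P be an arithmetic weak hyperdoctrine on C. If P satisfies both the Countable Axiom of Choice AC_N and Type-theoretic Church's Thesis (TCT), then P satisfies the schema of formal Church's Thesis (CT). -/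
universe u v w

namespace WHD

variable {C : FPCat} (P : WHD C)

/-- Kleene's formula `κ_R(e,x,y) := T(e,x,y) = 1 ∧ R(x, U(y))` over the base
`(N×N)×N` with coordinates `e, x, y`, relative to given test and output
arrows `T`, `U` and numeral `one = s(0)`. -/
def kappa {N : C.Obj} (one : C.Hom C.unit N)
    (T : C.Hom (C.prod (C.prod N N) N) N) (U : C.Hom N N)
    (R : P.fib (C.prod N N)) : P.fib (C.prod (C.prod N N) N) :=
  P.sub (C.pair T (C.comp (C.bang (C.prod (C.prod N N) N)) one)) (P.delta N) ⊓
  P.sub (C.pair (C.comp C.p1 C.p2) (C.comp C.p2 U)) R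

/-- The schema of formal Church's Thesis holds in `P` (relative to the given
Kleene arrows `T`, `U` and numeral `one = s(0)`):
for every `R` in `P(N×N)`,
`⊢ ∀x.∃n.R(x,n) ⟹ ∃e.∀x.∃y.(T(e,x,y)=1 ∧ R(x,U(y)))`. -/
def CTholds {N : C.Obj} (one : C.Hom C.unit N)
    (T : C.Hom (C.prod (C.prod N N) N) N) (U : C.Hom N N) : Prop :=
  ∀ R : P.fib (C.prod N N),
    (⊤ : P.fib C.unit) ≤
      (P.all (A := C.unit) (B := N) (P.sub C.p2 (P.ex R)) ⇨
        P.ex (A := C.unit) (B := N)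
          (P.sub C.p2 (P.all (P.ex (P.kappa one T U R)))))

section TCT

variable {N W : C.Obj} (one : C.Hom C.unit N)
  (T : C.Hom (C.prod (C.prod N N) N) N) (U : C.Hom N N)
  (ev : C.Hom (C.prod W N) N)

/-- The matrix `T(e,x,y) = 1 ∧ U(y) = ev(f,x)` of the sentence `TCT`, over the
base `((W×N)×N)×N` with coordinates `f, e, x, y`. -/
def tctMatrix : P.fib (C.prod (C.prod (C.prod W N) N) N) :=
  letI B4 := C.prod (C.prod (C.prod W N) N) N
  letI f : C.Hom B4 W := C.comp C.p1 (C.comp C.p1 C.p1)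
  letI e : C.Hom B4 N := C.comp C.p1 (C.comp C.p1 C.p2)
  letI x : C.Hom B4 N := C.comp C.p1 C.p2
  letI y : C.Hom B4 N := C.p2
  P.sub (C.pair (C.comp (C.pair (C.pair e x) y) T) (C.comp (C.bang B4) one))
      (P.delta N) ⊓
    P.sub (C.pair (C.comp y U) (C.comp (C.pair f x) ev)) (P.delta N)

/-- The sentence `∀f:W.∃e:N.∀x:N.∃y:N.(T(e,x,y) = 1 ∧ U(y) = ev(f,x))`. -/
def tctSentence : P.fib C.unit :=
  P.all (A := C.unit) (B := W)
    (P.sub C.p2 (P.ex (P.all (P.ex (P.tctMatrix one T U ev)))))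

end TCT

/-- The sentence of (formal) Type-theoretic Church's Thesis holds in `P`
(relative to the given Kleene arrows `T`, `U` and the numeral `one = s(0)`):
for some weak evaluation `ev : W × N → N` of a weak exponential of `N` with
`N`, `⊢ ∀f:W.∃e:N.∀x:N.∃y:N.(T(e,x,y) = 1 ∧ U(y) = ev(f,x))`. -/
def TCTholds {N : C.Obj} (one : C.Hom C.unit N)
    (T : C.Hom (C.prod (C.prod N N) N) N) (U : C.Hom N N) : Prop :=
  ∃ (W : C.Obj) (ev : C.Hom (C.prod W N) N), C.IsWeakEval ev ∧
    (⊤ : P.fib C.unit) ≤ P.tctSentence one T U ev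

end WHD

namespace FPCat

variable (C : FPCat)

attribute [simp] id_comp comp_id assoc pair_p1 pair_p2

@[simp] theorem pair_p1_assoc {X A B D : C.Obj} (f : C.Hom X A) (g : C.Hom X B) (h : C.Hom A D) :
    C.comp (C.pair f g) (C.comp C.p1 h) = C.comp f h := by
  rw [← C.assoc, C.pair_p1]

@[simp] theorem pair_p2_assoc {X A B D : C.Obj} (f : C.Hom X A) (g : C.Hom X B) (h : C.Hom B D) :
    C.comp (C.pair f g) (C.comp C.p2 h) = C.comp g h := by
  rw [← C.assoc, C.pair_p2]

@[simp] theorem comp_pair {Y X A B : C.Obj} (k : C.Hom Y X) (f : C.Hom X A) (g : C.Hom X B) :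
    C.comp k (C.pair f g) = C.pair (C.comp k f) (C.comp k g) := by
  rw [← C.pair_uniq (C.comp k (C.pair f g))]
  simp

@[simp] theorem pair_comp_pair {Y X A B D : C.Obj} (k : C.Hom Y X) (f : C.Hom X A)
    (g : C.Hom X B) (h : C.Hom (C.prod A B) D) :
    C.comp k (C.comp (C.pair f g) h) = C.comp (C.pair (C.comp k f) (C.comp k g)) h := by
  rw [← C.assoc, C.comp_pair]

@[simp] theorem comp_bang {X A : C.Obj} (f : C.Hom X A) : C.comp f (C.bang A) = C.bang X :=
  C.bang_uniq _

@[simp] theorem comp_bang_assoc {X A B : C.Obj} (f : C.Hom X A) (g : C.Hom C.unit B) :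
    C.comp f (C.comp (C.bang A) g) = C.comp (C.bang X) g := by
  rw [← C.assoc, comp_bang]

@[simp] theorem pair_p1_p2 {A B : C.Obj} : C.pair (C.p1 (A := A) (B := B)) C.p2 = C.id _ := by
  simpa using C.pair_uniq (C.id (C.prod A B))

end FPCat

namespace WHD

variable {C : FPCat} (P : WHD C)

theorem sub_mono_s3 {A B : C.Obj} (f : C.Hom A B) {α β : P.fib B} (h : α ≤ β) :
    P.sub f α ≤ P.sub f β := by
  rw [← inf_eq_left] at h ⊢
  rw [← P.sub_inf, h]

theorem le_sub_p1_ex {A B : C.Obj} (α : P.fib (C.prod A B)) : α ≤ P.sub C.p1 (P.ex α) :=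
  (P.ex_adj α _).1 le_rfl

theorem sub_p1_all_le {A B : C.Obj} (α : P.fib (C.prod A B)) : P.sub C.p1 (P.all α) ≤ α :=
  (P.all_adj α _).2 le_rfl

/-- Frobenius reciprocity, in the form of an elimination rule for `ex`. -/
theorem ex_inf_le {A B : C.Obj} {α : P.fib (C.prod A B)} {β γ : P.fib A}
    (h : α ⊓ P.sub C.p1 β ≤ P.sub C.p1 γ) : P.ex α ⊓ β ≤ γ := by
  rw [← le_himp_iff, P.ex_adj, P.sub_himp, le_himp_iff]
  exact h

/-- A witness proves an existential statement. -/
theorem sub_pair_le_ex {X A B : C.Obj} (f : C.Hom X A) (g : C.Hom X B)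
    (α : P.fib (C.prod A B)) : P.sub (C.pair f g) α ≤ P.sub f (P.ex α) := by
  have h := P.sub_mono_s3 (C.pair f g) (P.le_sub_p1_ex α)
  rwa [← P.sub_comp, C.pair_p1] at h

/-- A universal statement may be instantiated. -/
theorem sub_all_le_sub_pair {X A B : C.Obj} (f : C.Hom X A) (g : C.Hom X B)
    (α : P.fib (C.prod A B)) : P.sub f (P.all α) ≤ P.sub (C.pair f g) α := by
  have h := P.sub_mono_s3 (C.pair f g) (P.sub_p1_all_le α)
  rwa [← P.sub_comp, C.pair_p1] at h

/-- Equal terms may be substituted for each other. -/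
theorem delta_inf_le {X A : C.Obj} (f g : C.Hom X A) (φ : P.fib (C.prod X A)) :
    P.sub (C.pair f g) (P.delta A) ⊓ P.sub (C.pair (C.id X) g) φ ≤
      P.sub (C.pair (C.id X) f) φ := by
  have h := (P.delta_adj (⊤ : P.fib (C.prod X A))
    (P.sub (C.pair (C.comp C.p1 C.p1) C.p2) φ ⇨ P.sub C.p1 φ)).2 (by
      simp [P.sub_himp, ← P.sub_comp])
  have h' := P.sub_mono_s3 (C.pair (C.pair (C.id X) f) g) h
  simpa [P.sub_himp, P.sub_inf, P.sub_top, ← P.sub_comp, FPCat.pmap] using h'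

/-- If `f` is recursive with index `e` and chooses witnesses for `R`, then `e` satisfies Kleene's
formula for `R`. -/
theorem tctMatrix_inf_le_kappa {N W : C.Obj} (one : C.Hom C.unit N)
    (T : C.Hom (C.prod (C.prod N N) N) N) (U : C.Hom N N) (ev : C.Hom (C.prod W N) N)
    (R : P.fib (C.prod N N)) :
    P.tctMatrix one T U ev ⊓
        P.sub C.p1 (P.sub (C.pair (C.comp C.p1 C.p1) C.p2) (P.sub (C.pair C.p2 ev) R)) ≤
      P.sub (C.pmap (C.pmap C.p2 (C.id N)) (C.id N)) (P.kappa one T U R) := by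
  have h := P.delta_inf_le (X := C.prod (C.prod (C.prod W N) N) N) (C.comp C.p2 U)
    (C.comp (C.pair (C.comp C.p1 (C.comp C.p1 C.p1)) (C.comp C.p1 C.p2)) ev)
    (P.sub (C.pair (C.comp C.p1 (C.comp C.p1 C.p2)) C.p2) R)
  simp only [tctMatrix, kappa, FPCat.pmap, P.sub_inf, ← P.sub_comp] at h ⊢
  simp at h ⊢
  exact ⟨inf_le_left.trans inf_le_left, (inf_le_inf_right _ inf_le_right).trans h⟩

theorem index_inf_choice_le {N W : C.Obj} (one : C.Hom C.unit N)
    (T : C.Hom (C.prod (C.prod N N) N) N) (U : C.Hom N N) (ev : C.Hom (C.prod W N) N)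
    (R : P.fib (C.prod N N)) :
    P.all (P.ex (P.tctMatrix one T U ev)) ⊓
        P.sub C.p1 (P.all (P.sub (C.pair C.p2 ev) R)) ≤
      P.sub C.p2 (P.all (P.ex (P.kappa one T U R))) := by
  rw [P.bc_all C.p2, ← P.all_adj, P.sub_inf, ← P.bc_ex, ← P.sub_comp]
  refine (inf_le_inf (P.sub_p1_all_le _) (P.sub_all_le_sub_pair _ C.p2 _)).trans
    (P.ex_inf_le ?_)
  exact (P.tctMatrix_inf_le_kappa one T U ev R).trans (P.le_sub_p1_ex _)

end WHD

/-- STATEMENT 11.  Let `P` be an arithmetic weak hyperdoctrine on `C`, with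
pnno `(N, z, s)` and Kleene arrows `T`, `U` on it.  If `P` satisfies both the
Countable Axiom of Choice (the Axiom of Choice on `N`) and Type-theoretic
Church's Thesis, then `P` satisfies the schema of formal Church's Thesis. -/
theorem ct_of_countable_choice_and_tct
    (C : FPCat) (hwcc : C.WCC) (P : WHD C)
    (N : C.Obj) (z : C.Hom C.unit N) (s : C.Hom N N)
    (hpnno : C.IsPnno z s) (hind : P.SatInd z s)
    (T : C.Hom (C.prod (C.prod N N) N) N) (U : C.Hom N N)
    (hacn : P.ACon N) (htct : P.TCTholds (C.comp z s) T U) :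
    P.CTholds (C.comp z s) T U := by
  obtain ⟨W, ev, hev, htct⟩ := htct
  intro R
  rw [le_himp_iff, top_inf_eq]
  refine (hacn N W ev hev R).trans ?_
  rw [P.ex_adj]
  rw [WHD.tctSentence, ← P.all_adj, P.sub_top] at htct
  refine (le_inf (le_top.trans htct) le_rfl).trans ?_
  rw [← P.sub_inf]
  have key : P.ex (P.all (P.ex (P.tctMatrix (C.comp z s) T U ev))) ⊓
      P.all (P.sub (C.pair C.p2 ev) R) ≤ P.sub (C.bang W) (P.ex (A := C.unit) (B := N)
        (P.sub C.p2 (P.all (P.ex (P.kappa (C.comp z s) T U R))))) := by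
    refine P.ex_inf_le ((P.index_inf_choice_le _ T U ev R).trans ?_)
    have h := P.sub_pair_le_ex (C.bang (C.prod W N)) C.p2
      (P.sub C.p2 (P.all (P.ex (P.kappa (C.comp z s) T U R))))
    simpa [← P.sub_comp] using h
  have h := P.sub_mono_s3 (C.p2 (A := C.unit)) key
  rwa [← P.sub_comp _ (C.bang W), C.comp_bang, ← C.bang_uniq C.p1] at h
end
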